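/- arXiv:1406.2985 — 2 statements merged into one kernel-verified Lean document; each statement's English description precedes it below -/
import Mathlib

section
/- If S is finitely generated as a monoid, then for every 2-cocycle α on S with values in kˣ, the twisted semigroup algebra k^α[S] is a (left and right) Noetherian ring. -/
/-- Leading-term argument: an algebra spanned by elements `Y m`, indexed by a well-ordered
cancellative monoid `M` with the Dickson property, with `Y d * Y u` a nonzero multiple of
`Y (d + u)`, is left Noetherian. -/
lemma noeth_key {k A M : Type*} [Field k] [Ring A] [Algebra k A] [AddCommMonoid M]
    [LinearOrder M] [WellFoundedLT M] [IsOrderedCancelAddMonoid M]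
    (hwqo : ∀ f : ℕ → M, ∃ i j, i < j ∧ ∃ d, f j = d + f i)
    (Y : M → A) (hspan : Submodule.span k (Set.range Y) = ⊤)
    (hmul : ∀ d u, ∃ c : k, c ≠ 0 ∧ Y d * Y u = c • Y (d + u)) : IsNoetherianRing A := by
  let F : M → Submodule k A := fun w => Submodule.span k (Y '' Set.Iio w)
  let G : M → Submodule k A := fun w => Submodule.span k (Y '' Set.Iic w)
  have hGmono : Monotone G := fun a b h =>
    Submodule.span_mono (Set.image_mono (Set.Iic_subset_Iic.2 h))
  have hG : ∀ w, ∀ f ∈ G w, ∃ c : k, f - c • Y w ∈ F w := by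
    intro w f hf
    induction hf using Submodule.span_induction with
    | mem x hx =>
      obtain ⟨u, hu, rfl⟩ := hx
      rcases (show u ≤ w from hu).lt_or_eq with h | rfl
      · refine ⟨0, ?_⟩
        rw [zero_smul, sub_zero]
        exact Submodule.subset_span ⟨u, h, rfl⟩
      · exact ⟨1, by simp⟩
    | zero => exact ⟨0, by simp⟩
    | add x y _ _ hx hy =>
      obtain ⟨c, hc⟩ := hx
      obtain ⟨d, hd⟩ := hy
      refine ⟨c + d, ?_⟩
      convert (F w).add_mem hc hd using 1
      rw [add_smul]; abel
    | smul a x _ hx =>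
      obtain ⟨c, hc⟩ := hx
      refine ⟨a * c, ?_⟩
      convert (F w).smul_mem a hc using 1
      rw [smul_sub, mul_smul]
  have hF : ∀ w, ∀ f ∈ F w, f = 0 ∨ ∃ v, v < w ∧ f ∈ G v := by
    intro w f hf
    induction hf using Submodule.span_induction with
    | mem x hx =>
      obtain ⟨u, hu, rfl⟩ := hx
      exact Or.inr ⟨u, hu, Submodule.subset_span ⟨u, le_rfl, rfl⟩⟩
    | zero => exact Or.inl rfl
    | add x y _ _ hx hy =>
      rcases hx with rfl | ⟨a, ha, hxa⟩
      · simpa using hy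
      rcases hy with rfl | ⟨b, hb, hyb⟩
      · exact Or.inr ⟨a, ha, by simpa using hxa⟩
      · exact Or.inr ⟨max a b, max_lt ha hb,
          (G _).add_mem (hGmono (le_max_left _ _) hxa) (hGmono (le_max_right _ _) hyb)⟩
    | smul a x _ hx =>
      rcases hx with rfl | ⟨b, hb, hxb⟩
      · simp
      · exact Or.inr ⟨b, hb, (G _).smul_mem _ hxb⟩
  have hall : ∀ f : A, ∃ v, f ∈ G v := by
    intro f
    have hf : f ∈ Submodule.span k (Set.range Y) := hspan ▸ Submodule.mem_top
    induction hf using Submodule.span_induction with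
    | mem x hx =>
      obtain ⟨u, rfl⟩ := hx
      exact ⟨u, Submodule.subset_span ⟨u, le_rfl, rfl⟩⟩
    | zero => exact ⟨0, zero_mem _⟩
    | add x y _ _ hx hy =>
      obtain ⟨a, ha⟩ := hx
      obtain ⟨b, hb⟩ := hy
      exact ⟨max a b, (G _).add_mem (hGmono (le_max_left _ _) ha) (hGmono (le_max_right _ _) hb)⟩
    | smul a x _ hx =>
      obtain ⟨b, hb⟩ := hx
      exact ⟨b, (G _).smul_mem _ hb⟩
  have hFmul : ∀ d w, ∀ f ∈ F w, Y d * f ∈ F (d + w) := by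
    intro d w f hf
    induction hf using Submodule.span_induction with
    | mem x hx =>
      obtain ⟨u, hu, rfl⟩ := hx
      obtain ⟨c, -, hc⟩ := hmul d u
      rw [hc]
      exact (F _).smul_mem _ (Submodule.subset_span ⟨d + u, add_lt_add_right hu d, rfl⟩)
    | zero => simp
    | add x y _ _ hx hy => rw [mul_add]; exact (F _).add_mem hx hy
    | smul a x _ hx => rw [mul_smul_comm]; exact (F _).smul_mem _ hx
  have hsm : ∀ (I : Ideal A) (c : k) (f : A), f ∈ I → c • f ∈ I := by
    intro I c f hf
    rw [Algebra.smul_def]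
    exact I.mul_mem_left _ hf
  let L : Ideal A → Set M := fun I => {w | ∃ f ∈ I, f - Y w ∈ F w}
  have hLmono : Monotone L := fun I J h w ⟨f, hf, hw⟩ => ⟨f, h hf, hw⟩
  have hLup : ∀ I d w, w ∈ L I → d + w ∈ L I := by
    rintro I d w ⟨f, hf, hw⟩
    obtain ⟨c, hc0, hc⟩ := hmul d w
    refine ⟨c⁻¹ • (Y d * f), hsm _ _ _ (I.mul_mem_left _ hf), ?_⟩
    have := (F _).smul_mem c⁻¹ (hFmul d w _ hw)
    rwa [mul_sub, hc, smul_sub, inv_smul_smul₀ hc0] at this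
  have hLinj : ∀ I J : Ideal A, I ≤ J → L J ⊆ L I → J ≤ I := by
    intro I J hIJ hL
    have main : ∀ w, ∀ f ∈ J, f ∈ G w → f ∈ I := by
      intro w
      induction w using WellFoundedLT.induction with
      | ind w ih =>
      have low : ∀ f ∈ J, f ∈ F w → f ∈ I := by
        intro f hf hfw
        rcases hF w f hfw with rfl | ⟨v, hv, hfv⟩
        · exact zero_mem _
        · exact ih v hv f hf hfv
      intro f hf hfw
      obtain ⟨c, hc⟩ := hG w f hfw
      by_cases hc0 : c = 0
      · subst hc0
        exact low f hf (by simpa using hc)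
      have hw : w ∈ L J := by
        refine ⟨c⁻¹ • f, hsm _ _ _ hf, ?_⟩
        have := (F _).smul_mem c⁻¹ hc
        rwa [smul_sub, inv_smul_smul₀ hc0] at this
      obtain ⟨g, hg, hgw⟩ := hL hw
      have h1 : f - c • g ∈ I := by
        apply low _ (sub_mem hf (hsm _ _ _ (hIJ hg)))
        have := (F w).sub_mem hc ((F w).smul_mem c hgw)
        convert this using 1
        rw [smul_sub]; abel
      simpa using add_mem h1 (hsm _ c _ hg)
    intro f hf
    obtain ⟨v, hv⟩ := hall f
    exact main v f hf hv
  rw [isNoetherianRing_iff, isNoetherian_iff']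
  refine ⟨wellFounded_iff_isEmpty_descending_chain.2 ⟨?_⟩⟩
  rintro ⟨I, hI⟩
  have hI' : ∀ n, I n < I (n + 1) := hI
  have hmono : Monotone I := monotone_nat_of_le_succ fun n => (hI' n).le
  have hex : ∀ n, ∃ w, w ∈ L (I (n + 1)) ∧ w ∉ L (I n) := by
    intro n
    by_contra! h
    exact (hI' n).not_ge (hLinj _ _ (hI' n).le h)
  choose w hw hw' using hex
  obtain ⟨i, j, hij, d, hd⟩ := hwqo w
  apply hw' j
  rw [hd]
  exact hLup _ _ _ (hLmono (hmono hij) (hw i))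

/-- If the commutative cancellative monoid `S` is finitely generated, then for every
2-cocycle `α` on `S` with values in `kˣ`, the twisted semigroup algebra `k^α[S]`
(presented as a `k`-algebra with basis `{X^s : s ∈ S}` and multiplication
`X^s X^t = α(s,t) X^{s+t}`) is a left and right Noetherian ring. -/
theorem twisted_semigroup_algebra_noetherian
    {k : Type*} [Field k] {S : Type*} [AddCancelCommMonoid S]
    (hfg : AddMonoid.FG S)
    (α : S → S → kˣ)
    (hα : ∀ s t u : S, α s t * α (s + t) u = α t u * α s (t + u))
    (A : Type*) [Ring A] [Algebra k A] (X : S → A)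
    (hXli : LinearIndependent k X)
    (hXspan : Submodule.span k (Set.range X) = ⊤)
    (hXmul : ∀ s t : S, X s * X t = ((α s t : kˣ) : k) • X (s + t)) :
    IsNoetherianRing A ∧ IsNoetherianRing Aᵐᵒᵖ := by
  obtain ⟨n, φ, hφ⟩ : ∃ (n : ℕ) (φ : (Fin n → ℕ) →+ S), Function.Surjective φ := by
    obtain ⟨n, φ, hφ⟩ := AddSubmonoid.fg_iff_exists_fin_addMonoidHom.1 hfg.fg_top
    exact ⟨n, φ, AddMonoidHom.mrange_eq_top.1 hφ⟩
  have hwqo : ∀ f : ℕ → Lex (Fin n → ℕ), ∃ i j, i < j ∧ ∃ d, f j = d + f i := by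
    intro f
    obtain ⟨i, j, hij, h⟩ := wellQuasiOrdered_le (α := Fin n → ℕ) fun i => ofLex (f i)
    obtain ⟨d, hd⟩ := exists_add_of_le h
    exact ⟨i, j, hij, toLex d, by rw [add_comm]; exact hd⟩
  have hrange : Set.range (fun m : Lex (Fin n → ℕ) => X (φ (ofLex m))) = Set.range X :=
    (hφ.comp ofLex.surjective).range_comp X
  constructor
  · refine noeth_key (k := k) hwqo (fun m => X (φ (ofLex m))) (by rw [hrange, hXspan]) ?_
    intro d u
    exact ⟨_, (α (φ (ofLex d)) (φ (ofLex u))).ne_zero, by rw [hXmul, ofLex_add, map_add]⟩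
  · refine noeth_key (k := k) hwqo (fun m => MulOpposite.op (X (φ (ofLex m)))) ?_ ?_
    · have h := congrArg (Submodule.map (MulOpposite.opLinearEquiv k : A ≃ₗ[k] Aᵐᵒᵖ).toLinearMap)
        hXspan
      rw [Submodule.map_span, ← hrange, ← Set.range_comp, Submodule.map_top,
        LinearEquiv.range] at h
      exact h
    · intro d u
      refine ⟨_, (α (φ (ofLex u)) (φ (ofLex d))).ne_zero, ?_⟩
      rw [← MulOpposite.op_mul, hXmul, MulOpposite.op_smul, ofLex_add, map_add, add_comm]
end

section
/- Let S be a finitely generated submonoid of ℤˡ for some l ∈ ℕ (an affine semigroup). Then for every 2-cocycle α on S with values in kˣ, the twisted semigroup algebra k^α[S] is a Noetherian integral domain. -/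
theorem twisted_noeth_aux {k A M : Type*} [Field k] [Ring A] [Algebra k A]
    [AddCommMonoid M] [LinearOrder M] [IsOrderedCancelAddMonoid M] [WellFoundedLT M]
    (hM : ∀ m : ℕ → M, ∃ i j, i < j ∧ ∃ d, m j = d + m i)
    (Y : M → A) (β : M → M → kˣ)
    (hY : ∀ s t, Y s * Y t = ((β s t : kˣ) : k) • Y (s + t))
    (hspan : Submodule.span k (Set.range Y) = ⊤) : IsNoetherianRing A := by
  classical
  rw [isNoetherianRing_iff, isNoetherian_iff, RelEmbedding.wellFounded_iff_isEmpty]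
  refine ⟨fun I => ?_⟩
  have hI : ∀ i j, i < j → I i < I j := fun i j h => I.map_rel_iff.2 h
  set π := Finsupp.linearCombination k Y with hπ
  have hsurj : Function.Surjective π := by
    rw [← LinearMap.range_eq_top, Finsupp.range_linearCombination, hspan]
  let P : ℕ → M → Prop := fun i m => ∃ f : M →₀ k, π f ∈ I (i + 1) ∧ π f ∉ I i ∧
    (∀ x ∈ f.support, x ≤ m) ∧ f m ≠ 0
  have hP0 : ∀ i (f : M →₀ k), π f ∈ I (i + 1) → π f ∉ I i → ∃ m ∈ f.support, P i m := by
    intro i f h1 h2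
    have hne : f.support.Nonempty := by
      rw [Finsupp.support_nonempty_iff]
      rintro rfl
      simp at h2
    exact ⟨f.support.max' hne, f.support.max'_mem hne, f, h1, h2,
      fun x hx => f.support.le_max' x hx,
      Finsupp.mem_support_iff.1 (f.support.max'_mem hne)⟩
  have hmin : ∀ i, ∃ m, P i m ∧ ∀ m', P i m' → m ≤ m' := by
    intro i
    obtain ⟨a, ha, ha'⟩ := SetLike.exists_of_lt (hI i (i + 1) (Nat.lt_succ_self i))
    obtain ⟨f, rfl⟩ := hsurj a
    obtain ⟨m, -, hm⟩ := hP0 i f ha ha'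
    obtain ⟨m, h1, h2⟩ := (wellFounded_lt (α := M)).has_min {m | P i m} ⟨m, hm⟩
    exact ⟨m, h1, fun m' h => not_lt.1 (h2 m' h)⟩
  choose m hPm hmm using hmin
  obtain ⟨i, j, hij, d, hd⟩ := hM m
  obtain ⟨f, hf1, -, hf3, hf4⟩ := hPm i
  obtain ⟨g, hg1, hg2, hg3, hg4⟩ := hPm j
  let T : (M →₀ k) →ₗ[k] (M →₀ k) :=
    Finsupp.linearCombination k (fun x => Finsupp.single (d + x) ((β d x : kˣ) : k))
  have hπT : ∀ f, π (T f) = Y d * π f := by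
    intro f
    have : π ∘ₗ T = (LinearMap.mulLeft k (Y d)) ∘ₗ π := by
      ext x
      simp [π, T, hY]
    exact LinearMap.congr_fun this f
  have hTm : ∀ (f : M →₀ k) x, T f (d + x) = f x * β d x := by
    intro f x
    simp only [T, Finsupp.linearCombination_apply, Finsupp.sum, Finsupp.finset_sum_apply,
      Finsupp.smul_apply, Finsupp.single_apply, add_right_inj, smul_eq_mul, mul_ite, mul_zero]
    rw [Finset.sum_ite_eq']
    split_ifs with h
    · rfl
    · simp [Finsupp.notMem_support_iff.1 h]
  have hTs : ∀ y, T f y ≠ 0 → y ≤ m j := by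
    intro y hy
    by_contra hlt
    apply hy
    simp only [T, Finsupp.linearCombination_apply, Finsupp.sum, Finsupp.finset_sum_apply,
      Finsupp.smul_apply, smul_eq_mul]
    refine Finset.sum_eq_zero fun x hx => ?_
    rw [Finsupp.single_eq_of_ne, mul_zero]
    rintro rfl
    exact hlt (hd ▸ add_le_add_right (hf3 x hx) d)
  have hTf : T f (m j) ≠ 0 := by
    rw [hd, hTm]
    exact mul_ne_zero hf4 (Units.ne_zero _)
  have hle : I (i + 1) ≤ I j := by
    rcases (Nat.succ_le_of_lt hij).eq_or_lt with h | h
    · exact le_of_eq (congrArg I h)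
    · exact (hI _ _ h).le
  have hmem : (g (m j) / T f (m j)) • π (T f) ∈ I j := by
    rw [hπT]
    exact Submodule.smul_of_tower_mem _ _ (Ideal.mul_mem_left _ _ (hle hf1))
  set h := g - (g (m j) / T f (m j)) • T f with hh
  have hπh : π h = π g - (g (m j) / T f (m j)) • π (T f) := by
    rw [hh, map_sub, map_smul]
  obtain ⟨x, hx, hPx⟩ := hP0 j h
    (by rw [hπh]; exact sub_mem hg1 ((hI j (j + 1) (Nat.lt_succ_self j)).le hmem))
    (by
      rw [hπh]
      intro hc
      apply hg2
      have := add_mem hc hmem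
      rwa [sub_add_cancel] at this)
  have h1 := hmm j x hPx
  rw [Finsupp.mem_support_iff] at hx
  have h2 : x ≤ m j := by
    by_contra hc
    apply hx
    have e1 : g x = 0 := by
      by_contra h0
      exact hc (hg3 x (Finsupp.mem_support_iff.2 h0))
    have e2 : T f x = 0 := by
      by_contra h0
      exact hc (hTs x h0)
    simp [hh, e1, e2]
  have h3 : x = m j := le_antisymm h2 h1
  apply hx
  rw [h3, hh, Finsupp.sub_apply, Finsupp.smul_apply, smul_eq_mul, div_mul_cancel₀ _ hTf, sub_self]

theorem twisted_noeth {k : Type*} [Field k] {l : ℕ} (S : AddSubmonoid (Fin l → ℤ))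
    (hfg : S.FG) (α : S → S → kˣ)
    (A : Type*) [Ring A] [Algebra k A] (X : S → A)
    (hXspan : Submodule.span k (Set.range X) = ⊤)
    (hXmul : ∀ s t : S, X s * X t = ((α s t : kˣ) : k) • X (s + t)) :
    IsNoetherianRing A := by
  obtain ⟨n, φ, hφ⟩ := AddSubmonoid.fg_iff_exists_fin_addMonoidHom.1 hfg
  let ψ : Lex (Fin n → ℕ) → S := fun m => ⟨φ (ofLex m), hφ ▸ ⟨ofLex m, rfl⟩⟩
  have hψ : ∀ a b, ψ (a + b) = ψ a + ψ b := fun a b => Subtype.ext (map_add φ (ofLex a) (ofLex b))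
  have hsurj : Function.Surjective ψ := by
    rintro ⟨s, hs⟩
    have hs' := hs
    rw [← hφ] at hs'
    obtain ⟨m, hm⟩ := hs'
    exact ⟨toLex m, Subtype.ext hm⟩
  refine twisted_noeth_aux (k := k) (M := Lex (Fin n → ℕ)) ?_ (X ∘ ψ) (fun a b => α (ψ a) (ψ b)) ?_ ?_
  · intro m
    obtain ⟨i, j, hij, h⟩ := (WellQuasiOrderedLE.wqo (α := Fin n → ℕ)) (fun i => ofLex (m i))
    exact ⟨i, j, hij, toLex (ofLex (m j) - ofLex (m i)),
      congrArg toLex (tsub_add_cancel_of_le h).symm⟩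
  · intro s t
    simp [hXmul, hψ]
  · rw [hsurj.range_comp, hXspan]

theorem twisted_domain {k : Type*} [Field k] {S : Type*} [AddCommMonoid S] [UniqueSums S]
    (α : S → S → kˣ)
    (A : Type*) [Ring A] [Algebra k A] (X : S → A)
    (hXli : LinearIndependent k X)
    (hXspan : Submodule.span k (Set.range X) = ⊤)
    (hXmul : ∀ s t : S, X s * X t = ((α s t : kˣ) : k) • X (s + t)) :
    IsDomain A := by
  classical
  have : Nontrivial A := ⟨X 0, 0, hXli.ne_zero 0⟩
  have : NoZeroDivisors A := by
    refine ⟨fun {a b} hab => ?_⟩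
    by_contra! hne
    have hsurj : Function.Surjective (Finsupp.linearCombination k X) := by
      rw [← LinearMap.range_eq_top, Finsupp.range_linearCombination, hXspan]
    obtain ⟨f, rfl⟩ := hsurj a
    obtain ⟨g, rfl⟩ := hsurj b
    have hf : f.support.Nonempty := by
      rw [Finsupp.support_nonempty_iff]; rintro rfl; simp at hne
    have hg : g.support.Nonempty := by
      rw [Finsupp.support_nonempty_iff]; rintro rfl; simp at hne
    obtain ⟨s, hs, t, ht, hu⟩ := UniqueSums.uniqueAdd_of_nonempty hf hg
    let h : S →₀ k := ∑ x ∈ f.support, ∑ y ∈ g.support,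
      Finsupp.single (x + y) (f x * g y * α x y)
    have hh : Finsupp.linearCombination k X h = 0 := by
      rw [← hab]
      simp only [h, map_sum, Finsupp.linearCombination_single]
      rw [Finsupp.linearCombination_apply, Finsupp.linearCombination_apply, Finsupp.sum,
        Finsupp.sum, Finset.sum_mul_sum]
      refine Finset.sum_congr rfl fun x _ => Finset.sum_congr rfl fun y _ => ?_
      rw [smul_mul_smul_comm, hXmul, smul_smul]
    have h0 : h = 0 := (linearIndependent_iff.1 hXli) h hh
    have h1 : h (s + t) = f s * g t * α s t := by
      simp only [h, Finsupp.finset_sum_apply]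
      rw [Finset.sum_eq_single_of_mem s hs, Finset.sum_eq_single_of_mem t ht]
      · simp
      · intro y hy hyt
        rw [Finsupp.single_eq_of_ne]
        exact fun e => hyt (hu hs hy e.symm).2
      · intro x hx hxs
        refine Finset.sum_eq_zero fun y hy => ?_
        rw [Finsupp.single_eq_of_ne]
        exact fun e => hxs (hu hx hy e.symm).1
    rw [h0] at h1
    exact mul_ne_zero (mul_ne_zero (Finsupp.mem_support_iff.1 hs) (Finsupp.mem_support_iff.1 ht))
      (Units.ne_zero (α s t)) h1.symm
  exact NoZeroDivisors.to_isDomain A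


/-- Let `S` be a finitely generated submonoid of `ℤˡ` (an affine semigroup). Then for every
2-cocycle `α` on `S` with values in `kˣ`, the twisted semigroup algebra `k^α[S]`
(presented as a `k`-algebra with basis `{X^s : s ∈ S}` and multiplication
`X^s X^t = α(s,t) X^{s+t}`) is a Noetherian integral domain. -/
theorem twisted_affine_semigroup_algebra_noetherian_domain
    {k : Type*} [Field k] {l : ℕ} (S : AddSubmonoid (Fin l → ℤ))
    (hfg : S.FG)
    (α : S → S → kˣ)
    (hα : ∀ s t u : S, α s t * α (s + t) u = α t u * α s (t + u))
    (A : Type*) [Ring A] [Algebra k A] (X : S → A)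
    (hXli : LinearIndependent k X)
    (hXspan : Submodule.span k (Set.range X) = ⊤)
    (hXmul : ∀ s t : S, X s * X t = ((α s t : kˣ) : k) • X (s + t)) :
    IsNoetherianRing A ∧ IsNoetherianRing Aᵐᵒᵖ ∧ IsDomain A := by
  have hU : UniqueSums S := UniqueSums.of_injective_addHom (S.subtype : S →ₙ+ (Fin l → ℤ))
    Subtype.val_injective inferInstance
  refine ⟨twisted_noeth S hfg α A X hXspan hXmul, ?_, twisted_domain α A X hXli hXspan hXmul⟩
  refine twisted_noeth S hfg (fun s t => α t s) Aᵐᵒᵖ (fun s => MulOpposite.op (X s)) ?_ ?_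
  · have h := congrArg (Submodule.map (MulOpposite.opLinearEquiv k (M := A)).toLinearMap) hXspan
    rw [Submodule.map_span, Submodule.map_top, LinearEquiv.range, ← Set.range_comp] at h
    exact h
  · intro s t
    rw [← MulOpposite.op_mul, hXmul, MulOpposite.op_smul, add_comm]
end
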